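/- For every δ ∈ [0,2] and every v > 0: (1 − (1+v)e^{−v}) / v^δ ≤ 1/(1 + δ/2); equivalently, ME_δ := sup_{v>0} (1−(1+v)e^{−v})/v^δ ≤ 1/(1 + δ/2). -/

import Mathlib

open Real

/-- `ME δ = sup_{v>0} (1 - (1+v) e^{-v}) / v^δ`. -/
noncomputable def ME (δ : ℝ) : ℝ :=
  ⨆ v : Set.Ioi (0:ℝ), (1 - (1 + (v : ℝ)) * Real.exp (-(v : ℝ))) / (v : ℝ) ^ δ

theorem ME_aux (δ : ℝ) (hδ : δ ∈ Set.Icc (0:ℝ) 2) (v : ℝ) (hv : 0 < v) :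
      (1 - (1 + v) * Real.exp (-v)) / v ^ δ ≤ 1 / (1 + δ / 2) := by
  obtain ⟨h0, h2⟩ := hδ
  have he := Real.exp_pos (-v)
  have hp : 0 < (1 + v) * Real.exp (-v) := by positivity
  have hg0 : 0 ≤ 1 - (1 + v) * Real.exp (-v) := by
    have h1 : Real.exp v * Real.exp (-v) = 1 := by rw [← Real.exp_add]; simp
    nlinarith [Real.add_one_le_exp v]
  have hpow := Real.rpow_pos_of_pos hv δ
  rw [div_le_div_iff₀ hpow (by linarith), one_mul]
  rcases le_total v 1 with h | h
  · have h3 : v ^ (2:ℝ) ≤ v ^ δ := Real.rpow_le_rpow_of_exponent_ge hv h h2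
    rw [Real.rpow_two] at h3
    have h4 : 2 * (1 - (1 + v) * Real.exp (-v)) ≤ v ^ 2 := by
      have h1 : Real.exp v * Real.exp (-v) = 1 := by rw [← Real.exp_add]; simp
      have h5 := Real.exp_bound' hv.le h (n := 3) (by norm_num)
      simp [Finset.sum_range_succ, Nat.factorial] at h5
      have h6 : (1 - v^2/2) * Real.exp v ≤ 1 + v := by
        have h8 : 0 ≤ 1 - v^2/2 := by nlinarith
        have h7 : Real.exp v ≤ 1 + v + v^2/2 + 2/9*v^3 := by linarith
        have h9 := mul_le_mul_of_nonneg_left h7 h8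
        have : 0 ≤ v^3 := by positivity
        have : 0 ≤ v^4 := by positivity
        have : 0 ≤ v^5 := by positivity
        nlinarith
      have h10 := mul_le_mul_of_nonneg_right h6 he.le
      rw [mul_assoc, h1] at h10
      linarith
    nlinarith
  · have h3 : 1 + δ * Real.log v ≤ v ^ δ := by
      rw [Real.rpow_def_of_pos hv]
      linarith [Real.add_one_le_exp (Real.log v * δ)]
    have h4 : 2 * (1 - (1 + v) * Real.exp (-v)) ≤ 1 + 2 * Real.log v := by
      have hl := Real.one_sub_inv_le_log_of_pos hv
      have h5 : 2 * v⁻¹ - 1 ≤ 2 * ((1 + v) * Real.exp (-v)) := by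
        rcases le_total v 2 with h' | h'
        · have e1 : Real.exp (-v) = Real.exp (1 - v) / Real.exp 1 := by
            rw [← Real.exp_sub]; congr 1; ring
          have e2 := Real.add_one_le_exp (1 - v)
          have e3 : Real.exp 1 < 4 := by linarith [Real.exp_one_lt_d9]
          have e4 : (2 - v) / 4 ≤ Real.exp (-v) := by
            rw [e1]
            apply div_le_div₀ (Real.exp_pos _).le (by linarith) (Real.exp_pos _) e3.le
          have e5 : 2 * v⁻¹ - 1 = (2 - v) * v⁻¹ := by field_simp
          have e6 : v⁻¹ ≤ 1 := inv_le_one_of_one_le₀ h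
          have e7 : (2 - v) * v⁻¹ ≤ (2 - v) * 1 :=
            mul_le_mul_of_nonneg_left e6 (by linarith)
          rw [e5]
          nlinarith
        · have : v⁻¹ ≤ 2⁻¹ := inv_anti₀ (by norm_num) h'
          linarith
      linarith
    nlinarith

/-- (a12), first bound: for `δ ∈ [0,2]` and `v > 0`,
`(1 - (1+v)e^{-v})/v^δ ≤ 1/(1 + δ/2)`; equivalently `ME δ ≤ 1/(1 + δ/2)`. -/
theorem ME_le (δ : ℝ) (hδ : δ ∈ Set.Icc (0:ℝ) 2) :
    (∀ v : ℝ, 0 < v →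
      (1 - (1 + v) * Real.exp (-v)) / v ^ δ ≤ 1 / (1 + δ / 2)) ∧
    ME δ ≤ 1 / (1 + δ / 2) := by
  refine ⟨fun v hv => ME_aux δ hδ v hv, ?_⟩
  haveI : Nonempty (Set.Ioi (0:ℝ)) := ⟨⟨1, by simp⟩⟩
  exact ciSup_le fun v => ME_aux δ hδ v v.2
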